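/- Let q be a prime power and let w = (w_0, w_1, …, w_m) be a weight vector with 1 = w_0 ≤ w_1 = ⋯ = w_ℓ < w_{ℓ+1} ≤ ⋯ ≤ w_m and 1 ≤ ℓ ≤ m−1. If d ≥ 1 is divisible by lcm(w_1, …, w_m), then e_q(d; 1, w_1, …, w_m) = min{ p_m, (d/w_1)·q^{m−1} + p_{m−2} }. -/

import Mathlib

open MvPolynomial

noncomputable section

/-- `pSum q k = 1 + q + ⋯ + q^(k-1)`; so `p_m = pSum q (m+1)`. -/
def pSum (q k : ℕ) : ℕ := ∑ i ∈ Finset.range k, q ^ i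

/-- Equivalence of nonzero vectors under weighted scaling by the algebraic closure. -/
def wRel (F : Type) [Field F] {m : ℕ} (w : Fin (m + 1) → ℕ)
    (x y : {v : Fin (m + 1) → AlgebraicClosure F // v ≠ 0}) : Prop :=
  ∃ lam : (AlgebraicClosure F)ˣ, ∀ i, y.1 i = (lam : AlgebraicClosure F) ^ w i * x.1 i

/-- The weighted projective space `ℙ(w)` as set of orbits. -/
def PW (F : Type) [Field F] {m : ℕ} (w : Fin (m + 1) → ℕ) : Type :=
  Quot (wRel F w)

def PW.mk (F : Type) [Field F] {m : ℕ} (w : Fin (m + 1) → ℕ)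
    (x : {v : Fin (m + 1) → AlgebraicClosure F // v ≠ 0}) : PW F w :=
  Quot.mk _ x

/-- The `𝔽_q`-rational points of `ℙ(w)`: orbits fixed by coordinatewise Frobenius. -/
def ratPts (F : Type) [Field F] [Fintype F] {m : ℕ} (w : Fin (m + 1) → ℕ) :
    Set (PW F w) :=
  {c | ∃ x : {v : Fin (m + 1) → AlgebraicClosure F // v ≠ 0},
    PW.mk F w x = c ∧
    ∃ h : (fun i => x.1 i ^ Fintype.card F) ≠ (0 : Fin (m + 1) → AlgebraicClosure F),
      PW.mk F w ⟨fun i => x.1 i ^ Fintype.card F, h⟩ = c}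

/-- `V_{ℙ(w)}(f)(𝔽_q)`: the rational points at which `f` vanishes. -/
def vanishSet (F : Type) [Field F] [Fintype F] {m : ℕ} (w : Fin (m + 1) → ℕ)
    (f : MvPolynomial (Fin (m + 1)) F) : Set (PW F w) :=
  {c | c ∈ ratPts F w ∧ ∀ x, PW.mk F w x = c →
    MvPolynomial.eval x.1 (MvPolynomial.map (algebraMap F (AlgebraicClosure F)) f) = 0}

/-- `e_q(d; w)`: the maximal number of rational zeroes of a nonzero
weighted homogeneous polynomial of degree `d`. -/
def eMax (F : Type) [Field F] [Fintype F] {m : ℕ} (w : Fin (m + 1) → ℕ) (d : ℕ) : ℕ :=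
  sSup {n | ∃ f : MvPolynomial (Fin (m + 1)) F,
    f ≠ 0 ∧ MvPolynomial.IsWeightedHomogeneous w f d ∧ n = (vanishSet F w f).ncard}

/-- weighted degree of a monomial (exponent vector). -/
def wdeg {m : ℕ} (w : Fin (m + 1) → ℕ) (a : Fin (m + 1) →₀ ℕ) : ℕ := ∑ i, w i * a i

/-- degree-lexicographic order (weighted degree first, `x_0 < x_1 < ⋯ < x_m`). -/
def dlexLt {m : ℕ} (w : Fin (m + 1) → ℕ) (a b : Fin (m + 1) →₀ ℕ) : Prop :=
  wdeg w a < wdeg w b ∨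
    (wdeg w a = wdeg w b ∧ ∃ i, a i < b i ∧ ∀ j, i < j → a j = b j)

/-- `a` is the initial monomial of `f` for the weighted deglex order. -/
def IsInitial (F : Type) [Field F] {m : ℕ} (w : Fin (m + 1) → ℕ)
    (f : MvPolynomial (Fin (m + 1)) F) (a : Fin (m + 1) →₀ ℕ) : Prop :=
  a ∈ f.support ∧ ∀ b ∈ f.support, b ≠ a → dlexLt w b a

/-- The vanishing ideal `I(ℙ(w)(𝔽_q))`, generated by the homogeneous polynomials
vanishing at every rational point. -/
def vanishingIdeal (F : Type) [Field F] [Fintype F] {m : ℕ} (w : Fin (m + 1) → ℕ) :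
    Ideal (MvPolynomial (Fin (m + 1)) F) :=
  Ideal.span {g | (∃ e, MvPolynomial.IsWeightedHomogeneous w g e) ∧
    ∀ c ∈ ratPts F w, ∀ x, PW.mk F w x = c →
      MvPolynomial.eval x.1 (MvPolynomial.map (algebraMap F (AlgebraicClosure F)) g) = 0}

/-- `M̄`: monomials divisible by no initial monomial of a nonzero homogeneous
element of the vanishing ideal. -/
def Mbar (F : Type) [Field F] [Fintype F] {m : ℕ} (w : Fin (m + 1) → ℕ) :
    Set (Fin (m + 1) →₀ ℕ) :=
  {a | ¬ ∃ g : MvPolynomial (Fin (m + 1)) F, g ≠ 0 ∧ g ∈ vanishingIdeal F w ∧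
    (∃ e, MvPolynomial.IsWeightedHomogeneous w g e) ∧ ∃ b, IsInitial F w g b ∧ b ≤ a}

/-- `M̄_d`. -/
def MbarD (F : Type) [Field F] [Fintype F] {m : ℕ} (w : Fin (m + 1) → ℕ) (d : ℕ) :
    Set (Fin (m + 1) →₀ ℕ) :=
  {a ∈ Mbar F w | wdeg w a = d}

/-- `M̄_{d,i}`. -/
def MbarDI (F : Type) [Field F] [Fintype F] {m : ℕ} (w : Fin (m + 1) → ℕ) (d : ℕ)
    (i : Fin (m + 1)) : Set (Fin (m + 1) →₀ ℕ) :=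
  {a ∈ MbarD F w d | (∀ t, t < i → a t = 0) ∧ 1 ≤ a i}

/-- The regularity set `reg(ℙ(w)(𝔽_q)) = {d ≥ 1 : |M̄_d| = p_m}`. -/
def regSet (F : Type) [Field F] [Fintype F] {m : ℕ} (w : Fin (m + 1) → ℕ) : Set ℕ :=
  {d | 1 ≤ d ∧ (MbarD F w d).ncard = pSum (Fintype.card F) (m + 1)}

/-- Footprint bound at level `dtil`: number of monomials of `M̄_{dtil}` divisible by `a`. -/
def FB (F : Type) [Field F] [Fintype F] {m : ℕ} (w : Fin (m + 1) → ℕ) (dtil : ℕ)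
    (a : Fin (m + 1) →₀ ℕ) : ℕ :=
  {b | b ∈ MbarD F w dtil ∧ a ≤ b}.ncard

/-- `FB_i`: number of monomials of `M̄_{dtil, i}` divisible by `a`. -/
def FBi (F : Type) [Field F] [Fintype F] {m : ℕ} (w : Fin (m + 1) → ℕ) (dtil : ℕ)
    (i : Fin (m + 1)) (a : Fin (m + 1) →₀ ℕ) : ℕ :=
  {b | b ∈ MbarDI F w dtil i ∧ a ≤ b}.ncard

/-- Hilbert function of `𝔽_q[x]/I(ℙ(w)(𝔽_q))` at degree `d`. -/
def hilb (F : Type) [Field F] [Fintype F] {m : ℕ} (w : Fin (m + 1) → ℕ) (d : ℕ) : ℕ :=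
  Module.finrank F
    (↥(weightedHomogeneousSubmodule F w d) ⧸
      (Submodule.comap (weightedHomogeneousSubmodule F w d).subtype
        (Submodule.restrictScalars F (vanishingIdeal F w))))

/-- Denumerant: the number of representations `d = w0*i0 + w1*i1`. -/
def den (w0 w1 d : ℕ) : ℕ := {p : ℕ × ℕ | w0 * p.1 + w1 * p.2 = d}.ncard


open Classical in
/-- Number of zeros in affine space. -/
def ZN {F : Type} [Field F] [Fintype F] {n : ℕ} (p : MvPolynomial (Fin n) F) : ℕ :=
  (Finset.univ.filter (fun x : Fin n → F => eval x p = 0)).card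

lemma ZN_le_pow {F : Type} [Field F] [Fintype F] {n : ℕ} (p : MvPolynomial (Fin n) F) :
    ZN p ≤ Fintype.card F ^ n := by
  classical
  unfold ZN
  refine (Finset.card_le_univ _).trans ?_
  simp

lemma ZN_sz {F : Type} [Field F] [Fintype F] {n : ℕ} (p : MvPolynomial (Fin (n+1)) F)
    (hp : p ≠ 0) (D : ℕ) (hD : p.totalDegree ≤ D) : ZN p ≤ D * Fintype.card F ^ n := by
  classical
  have h := schwartz_zippel_totalDegree hp (Finset.univ : Finset F)
  have hq : (0:ℚ≥0) < Fintype.card F := by exact_mod_cast Fintype.card_pos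
  unfold ZN
  rw [← Finset.card_univ (α := F)] at hq ⊢
  rw [div_le_div_iff₀ (by positivity) hq] at h
  have h3 : ((Finset.univ.filter (fun x : Fin (n+1) → F => eval x p = 0)).card : ℚ≥0) *
     (Finset.univ : Finset F).card ≤ (p.totalDegree * (Finset.univ : Finset F).card ^ n) * (Finset.univ : Finset F).card := by
    calc _ = _ := by
            congr 3
      _ ≤ _ := h
      _ = _ := by ring
  have h4 := le_of_mul_le_mul_right h3 hq
  have h5 : (Finset.univ.filter (fun x : Fin (n+1) → F => eval x p = 0)).card ≤
      p.totalDegree * (Finset.univ : Finset F).card ^ n := by exact_mod_cast h4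
  calc _ ≤ _ := by convert h5
    _ ≤ _ := Nat.mul_le_mul_right _ hD

/-- Splitting zeros by first coordinate. -/
lemma ZN_fiber {F : Type} [Field F] [Fintype F] [DecidableEq F] {n : ℕ} (p : MvPolynomial (Fin (n+1)) F) :
    ZN p = ∑ y : Fin n → F, (Finset.univ.filter (fun t : F => eval (Fin.cons t y : Fin (n+1) → F) p = 0)).card := by
  classical
  unfold ZN
  rw [← Finset.card_sigma]
  symm
  refine Finset.card_bij' (fun a _ => (Fin.cons a.2 a.1 : Fin (n+1) → F)) (fun x _ => ⟨Fin.tail x, x 0⟩) ?_ ?_ ?_ ?_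
  · simp
  · intro a ha; simp at ha ⊢; exact ha
  · intro a ha; simp
  · intro a ha; simp

lemma ZN_fiber' {F : Type} [Field F] [Fintype F] [DecidableEq F] {n : ℕ} (p : MvPolynomial (Fin (n+1)) F) :
    ZN p = ∑ t : F, (Finset.univ.filter (fun y : Fin n → F => eval (Fin.cons t y : Fin (n+1) → F) p = 0)).card := by
  classical
  rw [ZN_fiber]
  simp only [Finset.card_filter]
  rw [Finset.sum_comm]

/-- Zero bound via leading coefficient in the first variable. -/
lemma ZN_lead {F : Type} [Field F] [Fintype F] {n : ℕ} (p : MvPolynomial (Fin (n+2)) F)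
    (hp : p ≠ 0) (e : ℕ) (he : 1 ≤ e) (heq : e ≤ Fintype.card F)
    (hk : ∃ a ∈ p.support, 1 ≤ a 0)
    (hdeg : ∀ a ∈ p.support, 1 ≤ a 0 → ∑ i, a i ≤ e - 1) :
    ZN p ≤ (e - 1) * Fintype.card F ^ (n+1) := by
  classical
  set q := Fintype.card F with hq
  set P := finSuccEquiv F (n+1) p with hP
  have hP0 : P ≠ 0 := by simpa [hP] using hp
  set k := P.natDegree with hkdef
  set c := P.leadingCoeff with hc
  have hc0 : c ≠ 0 := by simpa [hc] using hP0
  have hk1 : 1 ≤ k := by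
    obtain ⟨a, ha, ha1⟩ := hk
    have : a 0 ∈ P.support := by
      rw [hP, support_finSuccEquiv]
      exact Finset.mem_image_of_mem _ ha
    exact ha1.trans (Polynomial.le_natDegree_of_mem_supp _ this)
  have hmem : ∀ b ∈ c.support, ∑ i, b i + k ≤ e - 1 := by
    intro b hb
    have hb' : b.cons k ∈ p.support := by
      rw [← mem_support_coeff_finSuccEquiv]
      exact hb
    have := hdeg _ hb' (by simpa using hk1)
    rw [Fin.sum_univ_succ] at this
    simp only [Finsupp.cons_zero, Finsupp.cons_succ] at this
    omega
  obtain ⟨b0, hb0⟩ : c.support.Nonempty := by simpa [Finset.nonempty_iff_ne_empty] using hc0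
  have hke : k ≤ e - 1 := by have := hmem _ hb0; omega
  have hcdeg : c.totalDegree ≤ e - 1 - k := by
    unfold totalDegree
    rw [Finset.sup_le_iff]
    intro b hb
    have := hmem b hb
    rw [Finsupp.sum_fintype _ _ (by simp)]
    omega
  have hz := ZN_sz c hc0 _ hcdeg
  rw [ZN_fiber]
  have hy : ∀ y : Fin (n+1) → F, (Finset.univ.filter (fun t : F => eval (Fin.cons t y : Fin (n+2) → F) p = 0)).card
      ≤ (if eval y c = 0 then (q - k) else 0) + k := by
    intro y
    split_ifs with h
    · have : k ≤ q := by omega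
      rw [Nat.sub_add_cancel this]
      exact Finset.card_le_univ _
    · have hne : (P.map (eval y)) ≠ 0 := by
        intro h0
        apply h
        have : (P.map (eval y)).coeff k = 0 := by rw [h0]; simp
        rwa [Polynomial.coeff_map] at this
      rw [zero_add]
      have : (Finset.univ.filter (fun t : F => eval (Fin.cons t y : Fin (n+2) → F) p = 0)) ⊆ (P.map (eval y)).roots.toFinset := by
        intro t ht
        simp only [Finset.mem_filter, Finset.mem_univ, true_and] at ht
        rw [Multiset.mem_toFinset, Polynomial.mem_roots hne, Polynomial.IsRoot, ← eval_eq_eval_mv_eval']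
        exact ht
      calc _ ≤ _ := Finset.card_le_card this
        _ ≤ _ := Multiset.toFinset_card_le _
        _ ≤ _ := Polynomial.card_roots' _
        _ ≤ _ := Polynomial.natDegree_map_le
  calc _ ≤ ∑ y : Fin (n+1) → F, ((if eval y c = 0 then (q - k) else 0) + k) := Finset.sum_le_sum (fun y _ => hy y)
    _ = ZN c * (q - k) + q ^ (n+1) * k := by
      rw [Finset.sum_add_distrib, ← Finset.sum_filter]
      simp [ZN, hq]
    _ ≤ (e - 1 - k) * q ^ n * q + q ^ (n+1) * k := by
      gcongr
      omega
    _ = ((e - 1 - k) + k) * q ^ (n+1) := by ring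
    _ = _ := by rw [Nat.sub_add_cancel hke]
/-- Dehomogenization: set the first variable to one. -/
def dehom {F : Type} [Field F] {m : ℕ} (f : MvPolynomial (Fin (m+1)) F) : MvPolynomial (Fin m) F :=
  Polynomial.eval 1 (finSuccEquiv F m f)

/-- Set the first variable to zero. -/
def infpart {F : Type} [Field F] {m : ℕ} (f : MvPolynomial (Fin (m+1)) F) : MvPolynomial (Fin m) F :=
  (finSuccEquiv F m f).coeff 0

lemma eval_dehom {F : Type} [Field F] {m : ℕ} (f : MvPolynomial (Fin (m+1)) F) (y : Fin m → F) :
    eval y (dehom f) = eval (Fin.cons 1 y : Fin (m+1) → F) f := by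
  rw [eval_eq_eval_mv_eval', dehom]
  rw [Polynomial.eval_map, Polynomial.eval_eq_sum, Polynomial.eval₂_eq_sum, Polynomial.sum, Polynomial.sum]
  simp

lemma eval_infpart {F : Type} [Field F] {m : ℕ} (f : MvPolynomial (Fin (m+1)) F) (y : Fin m → F) :
    eval y (infpart f) = eval (Fin.cons 0 y : Fin (m+1) → F) f := by
  rw [eval_eq_eval_mv_eval', infpart, ← Polynomial.coeff_zero_eq_eval_zero, Polynomial.coeff_map]

lemma weight_eq_sum {n : ℕ} (w : Fin n → ℕ) (a : Fin n →₀ ℕ) :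
    Finsupp.weight w a = ∑ i, a i * w i := by
  rw [Finsupp.weight_apply, Finsupp.sum_fintype _ _ (by simp)]
  simp

lemma coeff_dehom {F : Type} [Field F] {m : ℕ} (f : MvPolynomial (Fin (m+1)) F) (b : Fin m →₀ ℕ) :
    coeff b (dehom f) = ∑ k ∈ (finSuccEquiv F m f).support, coeff (b.cons k) f := by
  rw [dehom, Polynomial.eval_eq_sum, Polynomial.sum, coeff_sum]
  refine Finset.sum_congr rfl fun k _ => ?_
  rw [one_pow, mul_one, finSuccEquiv_coeff_coeff]

lemma mem_support_dehom {F : Type} [Field F] {m : ℕ} (f : MvPolynomial (Fin (m+1)) F) (b : Fin m →₀ ℕ)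
    (hb : b ∈ (dehom f).support) : ∃ k, b.cons k ∈ f.support := by
  rw [mem_support_iff, coeff_dehom] at hb
  obtain ⟨k, _, hk⟩ := Finset.exists_ne_zero_of_sum_ne_zero hb
  exact ⟨k, by rwa [mem_support_iff]⟩

lemma mem_dehom_of {F : Type} [Field F] {m : ℕ} (f : MvPolynomial (Fin (m+1)) F) (w : Fin (m+1) → ℕ) (d : ℕ)
    (hw0 : 1 ≤ w 0) (hf : IsWeightedHomogeneous w f d) (a : Fin (m+1) →₀ ℕ) (ha : a ∈ f.support) :
    a.tail ∈ (dehom f).support := by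
  rw [mem_support_iff, coeff_dehom, Finset.sum_eq_single (a 0)]
  · rw [Finsupp.cons_tail]; exact mem_support_iff.1 ha
  · intro k _ hk
    by_contra h
    have h1 := hf h
    have h2 := hf (mem_support_iff.1 ha)
    rw [weight_eq_sum, Fin.sum_univ_succ] at h1 h2
    simp only [Finsupp.cons_zero, Finsupp.cons_succ, Finsupp.tail_apply] at h1
    have : k * w 0 = a 0 * w 0 := by omega
    exact hk (Nat.eq_of_mul_eq_mul_right hw0 this)
  · intro h
    exfalso; apply h
    rw [support_finSuccEquiv]
    exact Finset.mem_image_of_mem _ ha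

lemma dehom_ne_zero {F : Type} [Field F] {m : ℕ} (f : MvPolynomial (Fin (m+1)) F) (w : Fin (m+1) → ℕ) (d : ℕ)
    (hw0 : 1 ≤ w 0) (hf : IsWeightedHomogeneous w f d) (h0 : f ≠ 0) : dehom f ≠ 0 := by
  obtain ⟨a, ha⟩ : f.support.Nonempty := by simpa [Finset.nonempty_iff_ne_empty] using h0
  intro h
  have := mem_dehom_of f w d hw0 hf a ha
  simp [h] at this

lemma eval_scale {R : Type} [CommRing R] {n : ℕ} (f : MvPolynomial (Fin n) R) (w : Fin n → ℕ) (d : ℕ)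
    (hf : IsWeightedHomogeneous w f d) (c : R) (x : Fin n → R) :
    eval (fun i => c ^ w i * x i) f = c ^ d * eval x f := by
  rw [eval_eq', eval_eq', Finset.mul_sum]
  refine Finset.sum_congr rfl fun a ha => ?_
  have h := hf (mem_support_iff.1 ha)
  rw [weight_eq_sum] at h
  simp only [mul_pow, Finset.prod_mul_distrib, ← pow_mul]
  rw [← h, ← Finset.prod_pow_eq_pow_sum]
  simp only [mul_comm (w _)]
  ring

lemma ZN_split {F : Type} [Field F] [Fintype F] {m : ℕ} (f : MvPolynomial (Fin (m+1)) F)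
    (w : Fin (m+1) → ℕ) (d : ℕ) (hw0 : w 0 = 1) (hf : IsWeightedHomogeneous w f d) :
    ZN f = (Fintype.card F - 1) * ZN (dehom f) + ZN (infpart f) := by
  classical
  rw [ZN_fiber', ← Finset.sum_erase_add _ _ (Finset.mem_univ (0:F))]
  congr 1
  · rw [Finset.sum_congr rfl (g := fun _ => ZN (dehom f))]
    · simp [Finset.card_erase_of_mem]
    · intro c hc
      have hc0 : c ≠ 0 := by simpa using hc
      unfold ZN
      have key : ∀ (c : F) (y : Fin m → F), (Fin.cons c (fun i => c ^ w i.succ * y i) : Fin (m+1) → F) =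
          fun i => c ^ w i * (Fin.cons 1 y : Fin (m+1) → F) i := by
        intro c y
        funext i
        refine Fin.cases ?_ (fun i => ?_) i <;> simp [hw0]
      symm
      refine Finset.card_bij' (fun y _ i => c ^ w i.succ * y i) (fun y _ i => (c ^ w i.succ)⁻¹ * y i) ?_ ?_ ?_ ?_
      · intro y hy
        simp only [Finset.mem_filter, Finset.mem_univ, true_and, eval_dehom] at hy ⊢
        rw [key, eval_scale f w d hf, hy, mul_zero]
      · intro y hy
        simp only [Finset.mem_filter, Finset.mem_univ, true_and, eval_dehom] at hy ⊢
        have h2 := key c (fun i => (c ^ w i.succ)⁻¹ * y i)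
        have h3 : (fun i => c ^ w i.succ * ((c ^ w (Fin.succ i))⁻¹ * y i)) = y := by
          funext i; field_simp
        rw [h3] at h2
        rw [h2, eval_scale f w d hf] at hy
        exact (mul_eq_zero.1 hy).resolve_left (pow_ne_zero _ hc0)
      · intro y _; funext i; field_simp
      · intro y _; funext i; field_simp
  · unfold ZN
    simp only [eval_infpart]
lemma exists_mat {F : Type} [Field F] {n : ℕ} (a : Fin (n+1) → F) (ha : a ≠ 0) :
    ∃ A B : Matrix (Fin (n+1)) (Fin (n+1)) F, A * B = 1 ∧ B * A = 1 ∧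
      ∀ x, dotProduct a (A.mulVec x) = x 0 := by
  obtain ⟨i, hi⟩ := Function.ne_iff.1 ha
  simp only [Pi.zero_apply] at hi
  set C : Matrix (Fin (n+1)) (Fin (n+1)) F := (1 : Matrix (Fin (n+1)) (Fin (n+1)) F).updateRow i a with hC
  have hdet : C.det = a i := by
    rw [hC, ← Matrix.cramer_transpose_apply, Matrix.transpose_one, Matrix.cramer_one]; simp
  set B := C.submatrix (Equiv.swap 0 i) id with hB
  have hBdet : IsUnit B.det := by
    rw [hB, Matrix.det_permute, hdet, isUnit_iff_ne_zero]
    refine mul_ne_zero ?_ hi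
    rcases Int.units_eq_one_or (Equiv.Perm.sign (Equiv.swap 0 i)) with h | h <;> simp [h]
  refine ⟨B⁻¹, B, Matrix.nonsing_inv_mul _ hBdet, Matrix.mul_nonsing_inv _ hBdet, fun x => ?_⟩
  have hrow : B 0 = a := by
    funext j
    simp [hB, hC]
  have : dotProduct a (B⁻¹.mulVec x) = (B.mulVec (B⁻¹.mulVec x)) 0 := by
    rw [Matrix.mulVec, hrow]
  rw [this, Matrix.mulVec_mulVec, Matrix.mul_nonsing_inv _ hBdet, Matrix.one_mulVec]

/-- Linear substitution. -/
def subs {F : Type} [Field F] {n : ℕ} (A : Matrix (Fin n) (Fin n) F) (f : MvPolynomial (Fin n) F) :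
    MvPolynomial (Fin n) F := bind₁ A.toMvPolynomial f

lemma eval_subs {F : Type} [Field F] {n : ℕ} (A : Matrix (Fin n) (Fin n) F) (f : MvPolynomial (Fin n) F)
    (x : Fin n → F) : eval x (subs A f) = eval (A.mulVec x) f := by
  unfold subs
  have : eval x (bind₁ A.toMvPolynomial f) = eval₂Hom (RingHom.id F) x (bind₁ A.toMvPolynomial f) := rfl
  rw [this, eval₂Hom_bind₁]
  change eval (fun i => eval x (A.toMvPolynomial i)) f = _
  simp only [Matrix.toMvPolynomial_eval_eq_apply]

lemma subs_subs {F : Type} [Field F] {n : ℕ} (A B : Matrix (Fin n) (Fin n) F) (f : MvPolynomial (Fin n) F)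
    (h : A * B = 1) : subs B (subs A f) = f := by
  unfold subs
  rw [bind₁_bind₁]
  have : (fun i => bind₁ B.toMvPolynomial (A.toMvPolynomial i)) = X := by
    funext i
    rw [← Matrix.toMvPolynomial_mul, h, Matrix.toMvPolynomial_one]
  rw [this]
  simp

lemma subs_homog {F : Type} [Field F] {n : ℕ} (A : Matrix (Fin n) (Fin n) F) (f : MvPolynomial (Fin n) F)
    (e : ℕ) (hf : f.IsHomogeneous e) : (subs A f).IsHomogeneous e := by
  unfold subs
  have := hf.aeval (fun i => A.toMvPolynomial i) (fun i => Matrix.toMvPolynomial_isHomogeneous A i)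
  simpa using this

open Classical in
lemma ZN_subs {F : Type} [Field F] [Fintype F] {n : ℕ} (A B : Matrix (Fin n) (Fin n) F) (hAB : A * B = 1)
    (hBA : B * A = 1) (f : MvPolynomial (Fin n) F) : ZN (subs A f) = ZN f := by
  unfold ZN
  refine Finset.card_bij' (fun x _ => A.mulVec x) (fun x _ => B.mulVec x) ?_ ?_ ?_ ?_
  · intro x hx; simpa [eval_subs] using hx
  · intro x hx; simpa [eval_subs, hAB] using hx
  · intro x hx; simp [hBA]
  · intro x hx; simp [hAB]

open Classical in
lemma card_hyper {F : Type} [Field F] [Fintype F] {n : ℕ} (a : Fin (n+1) → F) (ha : a ≠ 0)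
    (f : MvPolynomial (Fin (n+1)) F) :
    ∃ A B : Matrix (Fin (n+1)) (Fin (n+1)) F, A * B = 1 ∧ B * A = 1 ∧
    (Finset.univ.filter (fun x : Fin (n+1) → F => eval x f = 0 ∧ dotProduct a x = 0)).card =
      ZN (infpart (subs A f)) := by
  obtain ⟨A, B, hAB, hBA, h⟩ := exists_mat a ha
  refine ⟨A, B, hAB, hBA, ?_⟩
  unfold ZN
  symm
  refine Finset.card_bij' (fun y _ => A.mulVec (Fin.cons 0 y : Fin (n+1) → F)) (fun x _ => Fin.tail (B.mulVec x)) ?_ ?_ ?_ ?_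
  · intro y hy
    simp only [Finset.mem_filter, Finset.mem_univ, true_and, eval_infpart, eval_subs] at hy ⊢
    refine ⟨hy, ?_⟩
    rw [h]; simp
  · intro x hx
    simp only [Finset.mem_filter, Finset.mem_univ, true_and, eval_infpart, eval_subs] at hx ⊢
    have h0 : (B.mulVec x) 0 = 0 := by
      rw [← h (B.mulVec x), Matrix.mulVec_mulVec, hAB, Matrix.one_mulVec]; exact hx.2
    have h1 : (Fin.cons 0 (Fin.tail (B.mulVec x)) : Fin (n+1) → F) = B.mulVec x := by
      conv_rhs => rw [← Fin.cons_self_tail (B.mulVec x), h0]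
    rw [h1, Matrix.mulVec_mulVec, hAB, Matrix.one_mulVec]
    exact hx.1
  · intro y hy
    simp [hBA]
  · intro x hx
    simp only [Finset.mem_filter, Finset.mem_univ, true_and] at hx
    have h0 : (B.mulVec x) 0 = 0 := by
      rw [← h (B.mulVec x), Matrix.mulVec_mulVec, hAB, Matrix.one_mulVec]; exact hx.2
    have h1 : (Fin.cons 0 (Fin.tail (B.mulVec x)) : Fin (n+1) → F) = B.mulVec x := by
      conv_rhs => rw [← Fin.cons_self_tail (B.mulVec x), h0]
    rw [h1, Matrix.mulVec_mulVec, hAB, Matrix.one_mulVec]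

open Classical in
lemma card_hyper0 {F : Type} [Field F] [Fintype F] {n : ℕ} (x : Fin (n+1) → F) (hx : x ≠ 0) :
    (Finset.univ.filter (fun a : Fin (n+1) → F => dotProduct a x = 0)).card = Fintype.card F ^ n := by
  obtain ⟨A, B, hAB, hBA, h⟩ := card_hyper x hx (0 : MvPolynomial (Fin (n+1)) F)
  have h0 : infpart (subs A (0 : MvPolynomial (Fin (n+1)) F)) = 0 := by simp [subs, infpart]
  rw [h0] at h
  simp only [map_zero, true_and, ZN] at h
  simp only [dotProduct_comm _ x]
  rw [h]
  simp

lemma infpart_homog {F : Type} [Field F] {m : ℕ} (f : MvPolynomial (Fin (m+1)) F) (e : ℕ)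
    (hf : f.IsHomogeneous e) : (infpart f).IsHomogeneous e := by
  intro b hb
  rw [infpart, finSuccEquiv_coeff_coeff] at hb
  have := hf hb
  rw [weight_eq_sum, Fin.sum_univ_succ] at this
  rw [weight_eq_sum]
  simpa using this

lemma ZN_one_var {F : Type} [Field F] [Fintype F] (p : MvPolynomial (Fin 1) F) (e : ℕ)
    (hf : p.IsHomogeneous e) (h0 : p ≠ 0) : ZN p ≤ 1 := by
  classical
  rw [ZN_split p 1 e rfl hf]
  have h1 : ZN (dehom p) = 0 := by
    have := dehom_ne_zero p 1 e le_rfl hf h0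
    unfold ZN
    rw [Finset.card_eq_zero, Finset.filter_eq_empty_iff]
    intro x _ hx
    apply this
    rw [eq_C_of_isEmpty (dehom p)] at hx ⊢
    rw [eval_C] at hx
    rw [hx, C_0]
  have h2 := ZN_le_pow (infpart p)
  rw [h1]
  simpa using h2

lemma serre_caseA {F : Type} [Field F] [Fintype F] {n : ℕ} (f : MvPolynomial (Fin (n+2)) F) (e : ℕ)
    (he : 1 ≤ e) (hf : f.IsHomogeneous e) (h0 : f ≠ 0) (hinf : infpart f = 0) :
    ZN f ≤ Fintype.card F ^ n * ((Fintype.card F - 1) * e + 1) := by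
  have hq : 1 ≤ Fintype.card F := Fintype.card_pos
  rw [ZN_split f 1 e rfl hf]
  have h1 : ZN (dehom f) ≤ (e - 1) * Fintype.card F ^ n := by
    apply ZN_sz _ (dehom_ne_zero f 1 e le_rfl hf h0)
    unfold totalDegree
    rw [Finset.sup_le_iff]
    intro b hb
    obtain ⟨k, hk⟩ := mem_support_dehom f b hb
    have hk0 : k ≠ 0 := by
      rintro rfl
      have : coeff b (infpart f) = coeff (b.cons 0) f := by rw [infpart, finSuccEquiv_coeff_coeff]
      rw [hinf] at this
      exact (mem_support_iff.1 hk) this.symm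
    have := hf (mem_support_iff.1 hk)
    rw [weight_eq_sum, Fin.sum_univ_succ] at this
    rw [Finsupp.sum_fintype _ _ (by simp)]
    simp at this
    omega
  have h2 := ZN_le_pow (infpart f)
  obtain ⟨e, rfl⟩ := Nat.exists_eq_add_of_le he
  obtain ⟨r, hr⟩ := Nat.exists_eq_add_of_le hq
  rw [hr] at h1 h2 ⊢
  simp only [Nat.add_sub_cancel_left] at h1 ⊢
  calc _ ≤ r * (e * (1 + r) ^ n) + (1+r)^(n+1) := by gcongr
    _ = _ := by ring

lemma serre_avg {F : Type} [Field F] [Fintype F] {n : ℕ} (f : MvPolynomial (Fin (n+2)) F) (e K : ℕ)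
    (he : 1 ≤ e) (hf : f.IsHomogeneous e) (hK : K ≤ Fintype.card F ^ (n+1))
    (H : ∀ A B : Matrix (Fin (n+2)) (Fin (n+2)) F, A * B = 1 → B * A = 1 → ZN (infpart (subs A f)) ≤ K) :
    ZN f ≤ Fintype.card F * K := by
  classical
  set q := Fintype.card F with hq
  have hq2 : 2 ≤ q := Fintype.one_lt_card
  set Z := Finset.univ.filter (fun x : Fin (n+2) → F => eval x f = 0) with hZ
  have hZN : ZN f = Z.card := by unfold ZN; congr
  have h0Z : (0 : Fin (n+2) → F) ∈ Z := by
    simp only [hZ, Finset.mem_filter, Finset.mem_univ, true_and]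
    have := eval_scale f 1 e hf (0:F) 0
    rw [zero_pow (by omega), zero_mul] at this
    rw [← this]
    congr 2
    funext i
    simp
  have hsum1 : ∑ a : Fin (n+2) → F, (Finset.univ.filter (fun x : Fin (n+2) → F => eval x f = 0 ∧ dotProduct a x = 0)).card
      = (Z.card - 1) * q ^ (n+1) + q ^ (n+2) := by
    calc _ = ∑ a : Fin (n+2) → F, ∑ x ∈ Z, (if dotProduct a x = 0 then 1 else 0) := by
          refine Finset.sum_congr rfl fun a _ => ?_
          rw [← Finset.card_filter, hZ, Finset.filter_filter]
      _ = ∑ x ∈ Z, (Finset.univ.filter (fun a : Fin (n+2) → F => dotProduct a x = 0)).card := by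
          rw [Finset.sum_comm]
          simp only [Finset.card_filter]
      _ = _ := by
          rw [← Finset.sum_erase_add _ _ h0Z]
          congr 1
          · rw [Finset.sum_congr rfl (g := fun _ => q ^ (n+1))]
            · simp [Finset.card_erase_of_mem h0Z]
            · intro x hx
              convert card_hyper0 x (Finset.ne_of_mem_erase hx)
          · simp [hq]
  have hsum2 : ∑ a : Fin (n+2) → F, (Finset.univ.filter (fun x : Fin (n+2) → F => eval x f = 0 ∧ dotProduct a x = 0)).card
      ≤ (q ^ (n+2) - 1) * K + Z.card := by
    rw [← Finset.sum_erase_add _ _ (Finset.mem_univ (0 : Fin (n+2) → F))]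
    have h1 : ∀ a ∈ Finset.univ.erase (0 : Fin (n+2) → F),
        (Finset.univ.filter (fun x : Fin (n+2) → F => eval x f = 0 ∧ dotProduct a x = 0)).card ≤ K := by
      intro a ha
      obtain ⟨A, B, hAB, hBA, h⟩ := card_hyper a (Finset.ne_of_mem_erase ha) f
      calc _ = _ := by convert h
        _ ≤ _ := H A B hAB hBA
    have h2 := Finset.sum_le_card_nsmul _ _ _ h1
    rw [Finset.card_erase_of_mem (Finset.mem_univ _)] at h2
    simp only [Finset.card_univ, Fintype.card_pi, Finset.prod_const, Fintype.card_fin, smul_eq_mul, ← hq] at h2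
    refine add_le_add h2 ?_
    simp [hZ]
  rw [hsum1] at hsum2
  rw [hZN]
  have hZ1 : 1 ≤ Z.card := Finset.card_pos.2 ⟨_, h0Z⟩
  have hQ1 : 1 ≤ q ^ (n+2) := Nat.one_le_pow _ _ (by omega)
  have hQ2 : 2 ≤ q ^ (n+1) := by
    calc 2 ≤ q := hq2
      _ = q ^ 1 := (pow_one q).symm
      _ ≤ _ := Nat.pow_le_pow_right (by omega) (by omega)
  generalize Z.card = N at *
  rw [pow_succ q (n+1)] at *
  generalize q ^ (n+1) = Q at *
  by_contra hlt
  push Not at hlt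
  zify [hZ1, hQ1] at *
  nlinarith [mul_nonneg (show (0:ℤ) ≤ N - q * K - 1 by linarith) (show (0:ℤ) ≤ Q - 1 by linarith),
    mul_nonneg (show (0:ℤ) ≤ q - 1 by linarith) (show (0:ℤ) ≤ Q - K by linarith)]

theorem serre {F : Type} [Field F] [Fintype F] {n : ℕ} (f : MvPolynomial (Fin (n+2)) F) (e : ℕ)
    (he : 1 ≤ e) (heq : e ≤ Fintype.card F + 1) (hf : f.IsHomogeneous e) (h0 : f ≠ 0) :
    ZN f ≤ Fintype.card F ^ n * ((Fintype.card F - 1) * e + 1) := by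
  have hq2 : 2 ≤ Fintype.card F := Fintype.one_lt_card
  have hnz : ∀ {k : ℕ} (f : MvPolynomial (Fin k) F), f ≠ 0 → ∀ A B : Matrix (Fin k) (Fin k) F,
      A * B = 1 → subs A f ≠ 0 := by
    intro k f h0 A B hAB h
    apply h0
    rw [← subs_subs A B f hAB, h]
    simp [subs]
  induction n with
  | zero =>
    by_cases hA : ∃ A B : Matrix (Fin 2) (Fin 2) F, A * B = 1 ∧ B * A = 1 ∧ infpart (subs A f) = 0
    · obtain ⟨A, B, hAB, hBA, h⟩ := hA
      rw [← ZN_subs A B hAB hBA f]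
      exact serre_caseA (n := 0) _ e he (subs_homog _ _ _ hf) (hnz f h0 A B hAB) h
    · push Not at hA
      have := serre_avg (n := 0) f e 1 he hf (Nat.one_le_pow _ _ (by omega)) (fun A B hAB hBA =>
        ZN_one_var _ e (infpart_homog _ _ (subs_homog _ _ _ hf)) (hA A B hAB hBA))
      refine this.trans ?_
      obtain ⟨r, hr⟩ := Nat.exists_eq_add_of_le hq2
      rw [hr]
      have : 2 + r - 1 = 1 + r := by omega
      rw [this]
      nlinarith
  | succ n ih =>
    by_cases hA : ∃ A B : Matrix (Fin (n+1+2)) (Fin (n+1+2)) F, A * B = 1 ∧ B * A = 1 ∧ infpart (subs A f) = 0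
    · obtain ⟨A, B, hAB, hBA, h⟩ := hA
      rw [← ZN_subs A B hAB hBA f]
      exact serre_caseA _ e he (subs_homog _ _ _ hf) (hnz f h0 A B hAB) h
    · push Not at hA
      have := serre_avg f e (Fintype.card F ^ n * ((Fintype.card F - 1) * e + 1)) he hf ?_ (fun A B hAB hBA =>
        ih _ (infpart_homog _ _ (subs_homog _ _ _ hf)) (hA A B hAB hBA))
      · calc _ ≤ _ := this
          _ = _ := by ring
      · rw [add_assoc, pow_add]
        apply Nat.mul_le_mul_left
        obtain ⟨r, hr⟩ := Nat.exists_eq_add_of_le hq2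
        rw [hr] at heq ⊢
        have : 2 + r - 1 = 1 + r := by omega
        rw [this]
        calc _ ≤ (1 + r) * (2 + r + 1) + 1 := by gcongr
          _ = _ := by ring
lemma ZN_rename {F : Type} [Field F] [Fintype F] {n : ℕ} (σ : Fin n ≃ Fin n) (p : MvPolynomial (Fin n) F) :
    ZN (rename σ p) = ZN p := by
  classical
  unfold ZN
  refine Finset.card_bij' (fun x _ => x ∘ σ) (fun x _ => x ∘ σ.symm) ?_ ?_ ?_ ?_
  · intro x hx; simpa [eval_rename] using hx
  · intro x hx; simpa [eval_rename, Function.comp_assoc] using hx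
  · intro x hx; simp [Function.comp_assoc]
  · intro x hx; simp [Function.comp_assoc]

lemma upper_caseI {F : Type} [Field F] [Fintype F] {n : ℕ} (w : Fin (n+3) → ℕ) (hw0 : w 0 = 1)
    (w1 : ℕ) (hw : ∀ i : Fin (n+2), w1 ≤ w i.succ) (d e : ℕ) (hde : d = e * w1)
    (he : 1 ≤ e) (heq : e ≤ Fintype.card F) (f : MvPolynomial (Fin (n+3)) F)
    (hf : IsWeightedHomogeneous w f d) (h0 : f ≠ 0)
    (j : Fin (n+2)) (hj : w1 < w j.succ) (a : Fin (n+3) →₀ ℕ) (ha : a ∈ f.support) (haj : 1 ≤ a j.succ) :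
    ZN (dehom f) ≤ (e - 1) * Fintype.card F ^ (n+1) := by
  classical
  set σ : Fin (n+2) ≃ Fin (n+2) := Equiv.swap 0 j with hσ
  rw [← ZN_rename σ]
  have hsupp : ∀ b, b ∈ (rename σ (dehom f)).support ↔ ∃ c ∈ (dehom f).support, c.mapDomain σ = b := by
    intro b
    rw [support_rename_of_injective σ.injective, Finset.mem_image]
  have hσj : σ j = 0 := by simp [hσ]
  have hval : ∀ (c : Fin (n+2) →₀ ℕ) i, (c.mapDomain σ) (σ i) = c i := by
    intro c i
    exact Finsupp.mapDomain_apply σ.injective _ _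
  apply ZN_lead _ _ e he heq
  · refine ⟨a.tail.mapDomain σ, (hsupp _).2 ⟨_, mem_dehom_of f w d hw0.ge hf a ha, rfl⟩, ?_⟩
    rw [← hσj, hval]
    rw [Finsupp.tail_apply]; exact haj
  · intro b hb hb0
    obtain ⟨c, hc, rfl⟩ := (hsupp _).1 hb
    rw [← hσj, hval] at hb0
    rw [← Equiv.sum_comp σ]
    simp only [hval]
    obtain ⟨k, hk⟩ := mem_support_dehom f c hc
    have h := hf (mem_support_iff.1 hk)
    rw [weight_eq_sum, Fin.sum_univ_succ] at h
    simp only [Finsupp.cons_zero, Finsupp.cons_succ] at h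
    have hlt : ∑ i, c i * w1 < ∑ i : Fin (n+2), c i * w i.succ := by
      apply Finset.sum_lt_sum
      · intro i _; exact Nat.mul_le_mul_left _ (hw i)
      · exact ⟨j, Finset.mem_univ _, Nat.mul_lt_mul_of_pos_left hj hb0⟩
    rw [← Finset.sum_mul] at hlt
    have : (∑ i, c i) * w1 < e * w1 := by omega
    have := lt_of_mul_lt_mul_right this (Nat.zero_le _)
    omega
  · intro h
    apply dehom_ne_zero f w d hw0.ge hf h0
    exact rename_injective σ σ.injective (by simpa using h)

lemma upper_caseII {F : Type} [Field F] [Fintype F] {n : ℕ} (w : Fin (n+2) → ℕ) (hw0 : w 0 = 1)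
    (w1 : ℕ) (hw1 : 1 ≤ w1) (d e : ℕ) (hde : d = e * w1)
    (he : 1 ≤ e) (heq : e ≤ Fintype.card F) (f : MvPolynomial (Fin (n+2)) F)
    (hf : IsWeightedHomogeneous w f d) (h0 : f ≠ 0)
    (H : ∀ a ∈ f.support, ∀ j : Fin (n+1), 1 ≤ a j.succ → w j.succ = w1) :
    ZN f ≤ Fintype.card F ^ n * ((Fintype.card F - 1) * e + 1) := by
  classical
  have key : ∀ a ∈ f.support, a 0 + (∑ i : Fin (n+1), a i.succ) * w1 = e * w1 := by
    intro a ha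
    have h := hf (mem_support_iff.1 ha)
    rw [weight_eq_sum, Fin.sum_univ_succ, hw0, mul_one, hde] at h
    rw [← h, Finset.sum_mul]
    congr 1
    refine Finset.sum_congr rfl fun j _ => ?_
    rcases Nat.eq_zero_or_pos (a j.succ) with h1 | h1
    · simp [h1]
    · rw [H a ha j h1]
  have hdvd : ∀ a ∈ f.support, a 0 / w1 * w1 = a 0 := by
    intro a ha
    apply Nat.div_mul_cancel
    have h := key a ha
    rw [← Nat.dvd_add_left (Dvd.intro_left _ rfl), h]
    exact Dvd.intro_left _ rfl
  set g : MvPolynomial (Fin (n+2)) F := ∑ a ∈ f.support, monomial (a.tail.cons (a 0 / w1)) (coeff a f) with hg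
  have hgh : g.IsHomogeneous e := by
    apply IsHomogeneous.sum
    intro a ha
    apply isHomogeneous_monomial
    rw [Finsupp.degree_eq_sum, Fin.sum_univ_succ]
    simp only [Finsupp.cons_zero, Finsupp.cons_succ, Finsupp.tail_apply]
    have h := key a ha
    rw [← hdvd a ha, ← add_mul] at h
    exact Nat.eq_of_mul_eq_mul_right hw1 h
  set φ : Fin (n+2) → MvPolynomial (Fin (n+2)) F := Fin.cons (X 0 ^ w1) (fun i => X i.succ) with hφ
  have hfg : bind₁ φ g = f := by
    conv_rhs => rw [f.as_sum]
    rw [hg, map_sum]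
    refine Finset.sum_congr rfl fun a ha => ?_
    rw [bind₁_monomial, monomial_eq, Finsupp.prod_fintype _ _ (by simp)]
    congr 1
    change Finsupp.prod (a.tail.cons (a 0 / w1)) (fun i k => φ i ^ k) = _
    rw [Finsupp.prod_fintype _ _ (by simp)]
    rw [Fin.prod_univ_succ]
    conv_rhs => rw [Fin.prod_univ_succ]
    simp only [hφ, Finsupp.cons_zero, Finsupp.cons_succ, Finsupp.tail_apply, Fin.cons_zero, Fin.cons_succ]
    rw [← pow_mul, mul_comm w1, hdvd a ha]
  have hg0 : g ≠ 0 := by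
    intro h
    apply h0
    rw [← hfg, h, map_zero]
  have hev : ∀ x, eval x f = eval (Fin.cons (x 0 ^ w1) (Fin.tail x) : Fin (n+2) → F) g := by
    intro x
    conv_lhs => rw [← hfg]
    change eval₂Hom (RingHom.id F) x (bind₁ φ g) = _
    rw [eval₂Hom_bind₁]
    change eval (fun i => eval x (φ i)) g = _
    congr 2
    funext i
    refine Fin.cases ?_ (fun i => ?_) i
    · simp [hφ]
    · simp [hφ, Fin.tail]
  have hs := serre g e he (by omega) hgh hg0
  rw [ZN_split g 1 e rfl hgh] at hs
  rw [ZN_split f w d hw0 hf]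
  have e1 : ZN (dehom f) = ZN (dehom g) := by
    unfold ZN
    simp only [eval_dehom, hev]
    simp
  have e2 : ZN (infpart f) = ZN (infpart g) := by
    unfold ZN
    simp only [eval_infpart, hev]
    simp [zero_pow (show w1 ≠ 0 by omega)]
  rw [e1, e2]
  exact hs

theorem upper {F : Type} [Field F] [Fintype F] {n : ℕ} (w : Fin (n+3) → ℕ) (hw0 : w 0 = 1)
    (w1 : ℕ) (hw1 : 1 ≤ w1) (hw : ∀ i : Fin (n+2), w1 ≤ w i.succ) (d e : ℕ) (hde : d = e * w1)
    (he : 1 ≤ e) (f : MvPolynomial (Fin (n+3)) F)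
    (hf : IsWeightedHomogeneous w f d) (h0 : f ≠ 0) :
    ZN f ≤ Fintype.card F ^ (n+1) * ((Fintype.card F - 1) * e + 1) := by
  have hq : 1 ≤ Fintype.card F := Fintype.card_pos
  by_cases heq : e ≤ Fintype.card F
  · by_cases H : ∃ a ∈ f.support, ∃ j : Fin (n+2), 1 ≤ a j.succ ∧ w j.succ ≠ w1
    · obtain ⟨a, ha, j, haj, hj⟩ := H
      have h1 := upper_caseI w hw0 w1 hw d e hde he heq f hf h0 j (lt_of_le_of_ne (hw j) (Ne.symm hj)) a ha haj
      rw [ZN_split f w d hw0 hf]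
      have h2 := ZN_le_pow (infpart f)
      obtain ⟨e, rfl⟩ := Nat.exists_eq_add_of_le he
      obtain ⟨r, hr⟩ := Nat.exists_eq_add_of_le hq
      rw [hr] at h1 h2 ⊢
      simp only [Nat.add_sub_cancel_left] at h1 ⊢
      calc _ ≤ r * (e * (1 + r) ^ (n+1)) + (1+r)^(n+2) := by gcongr
        _ = _ := by ring
    · push Not at H
      exact upper_caseII w hw0 w1 hw1 d e hde he heq f hf h0 H
  · refine (ZN_le_pow f).trans ?_
    rw [show n + 3 = n + 1 + 2 by ring, pow_add]
    apply Nat.mul_le_mul_left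
    obtain ⟨r, hr⟩ := Nat.exists_eq_add_of_le hq
    rw [hr] at heq ⊢
    simp only [Nat.add_sub_cancel_left]
    calc _ = r * (1 + r + 1) + 1 := by ring
      _ ≤ _ := by gcongr; omega
lemma exists_of_pow_card {F : Type} [Field F] [Fintype F] (z : AlgebraicClosure F)
    (hz : z ^ Fintype.card F = z) : ∃ t : F, algebraMap F (AlgebraicClosure F) t = z := by
  classical
  have h1 : 1 < Fintype.card F := Fintype.one_lt_card
  set P : Polynomial (AlgebraicClosure F) := Polynomial.X ^ Fintype.card F - Polynomial.X with hP
  have hP0 : P ≠ 0 := FiniteField.X_pow_card_sub_X_ne_zero _ h1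
  have hdeg : P.natDegree = Fintype.card F := FiniteField.X_pow_card_sub_X_natDegree_eq _ h1
  set I := Finset.univ.image (algebraMap F (AlgebraicClosure F)) with hI
  have hIc : I.card = Fintype.card F := by
    rw [hI, Finset.card_image_of_injective _ (algebraMap F (AlgebraicClosure F)).injective, Finset.card_univ]
  have hsub : I ⊆ P.roots.toFinset := by
    intro y hy
    obtain ⟨t, _, rfl⟩ := Finset.mem_image.1 hy
    rw [Multiset.mem_toFinset, Polynomial.mem_roots hP0]
    simp [hP, ← map_pow, FiniteField.pow_card]
  have heq : I = P.roots.toFinset := by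
    apply Finset.eq_of_subset_of_card_le hsub
    rw [hIc, ← hdeg]
    exact (Multiset.toFinset_card_le _).trans (Polynomial.card_roots' _)
  have hzm : z ∈ P.roots.toFinset := by
    rw [Multiset.mem_toFinset, Polynomial.mem_roots hP0]
    simp [hP, hz]
  rw [← heq, hI] at hzm
  obtain ⟨t, _, ht⟩ := Finset.mem_image.1 hzm
  exact ⟨t, ht⟩

lemma wRel_equiv (F : Type) [Field F] {m : ℕ} (w : Fin (m + 1) → ℕ) : Equivalence (wRel F w) := by
  refine ⟨fun x => ⟨1, fun i => by simp⟩, ?_, ?_⟩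
  · rintro x y ⟨l, h⟩
    refine ⟨l⁻¹, fun i => ?_⟩
    rw [h i, ← mul_assoc, ← mul_pow]
    simp
  · rintro x y z ⟨l, h⟩ ⟨l', h'⟩
    refine ⟨l' * l, fun i => ?_⟩
    rw [h' i, h i]
    push_cast
    ring

lemma mk_eq_iff (F : Type) [Field F] {m : ℕ} (w : Fin (m + 1) → ℕ)
    (x y : {v : Fin (m + 1) → AlgebraicClosure F // v ≠ 0}) :
    PW.mk F w x = PW.mk F w y ↔ wRel F w x y := by
  constructor
  · intro h
    have := Quot.eqvGen_exact h
    rwa [(wRel_equiv F w).eqvGen_iff] at this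
  · intro h; exact Quot.sound h

open Classical in
lemma card_orbit {F : Type} [Field F] [Fintype F] {n : ℕ} (w : Fin n → ℕ) (hpos : ∀ i, 1 ≤ w i)
    (x : Fin n → F) (hx : x ≠ 0) :
    (Finset.univ.filter (fun y : Fin n → F => ∃ l : (AlgebraicClosure F)ˣ, ∀ i,
      algebraMap F (AlgebraicClosure F) (y i) = (l : AlgebraicClosure F) ^ w i *
        algebraMap F (AlgebraicClosure F) (x i))).card = Fintype.card F - 1 := by
  set S := Finset.univ.filter (fun i => x i ≠ 0) with hS
  obtain ⟨i0, hi0⟩ := Function.ne_iff.1 hx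
  have hi0S : i0 ∈ S := by simpa [hS] using hi0
  obtain ⟨g, hg, hg1⟩ := Finset.extract_gcd w ⟨i0, hi0S⟩
  set G := S.gcd w with hG
  have hGpos : 0 < G := by
    rcases Nat.eq_zero_or_pos G with h | h
    · have := hg i0 hi0S
      rw [h, zero_mul] at this
      have := hpos i0
      omega
    · exact h
  set φ : Fˣ → (Fin n → F) := fun u i => (u : F) ^ g i * x i with hφ
  have hinj : Function.Injective φ := by
    intro u v huv
    have h1 : ∀ i ∈ S, orderOf (u / v) ∣ g i := by
      intro i hi
      have hxi : x i ≠ 0 := by simpa [hS] using hi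
      have h2 := congrFun huv i
      simp only [hφ] at h2
      have h3 := mul_right_cancel₀ hxi h2
      rw [orderOf_dvd_iff_pow_eq_one, div_pow, div_eq_one]
      ext
      simpa using h3
    have h2 := Finset.dvd_gcd h1
    rw [hg1, Nat.dvd_one, orderOf_eq_one_iff, div_eq_one] at h2
    exact h2
  rw [← Fintype.card_units, ← Finset.card_univ, ← Finset.card_image_of_injective _ hinj]
  congr 1
  ext y
  simp only [Finset.mem_filter, Finset.mem_univ, true_and, Finset.mem_image]
  constructor
  · rintro ⟨l, hl⟩
    have hq2 : 1 < Fintype.card F := Fintype.one_lt_card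
    have h1 : ∀ i ∈ S, orderOf (l ^ (Fintype.card F - 1)) ∣ w i := by
      intro i hi
      have hxi : x i ≠ 0 := by simpa [hS] using hi
      have hyi : y i ≠ 0 := by
        intro h
        have := hl i
        rw [h, map_zero] at this
        have h3 := mul_eq_zero.1 this.symm
        simp [hxi] at h3
      rw [orderOf_dvd_iff_pow_eq_one]
      ext
      push_cast
      have h3 := congrArg (· ^ (Fintype.card F - 1)) (hl i)
      simp only [mul_pow, ← map_pow, FiniteField.pow_card_sub_one_eq_one _ hxi,
        FiniteField.pow_card_sub_one_eq_one _ hyi, map_one, mul_one] at h3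
      rw [h3, ← pow_mul, ← pow_mul, mul_comm]
    have h2 := Finset.dvd_gcd h1
    rw [← hG, orderOf_dvd_iff_pow_eq_one] at h2
    have h3 : ((l : AlgebraicClosure F) ^ G) ^ Fintype.card F = (l : AlgebraicClosure F) ^ G := by
      have h4 := congrArg (fun u : (AlgebraicClosure F)ˣ => (u : AlgebraicClosure F)) h2
      simp only [Units.val_pow_eq_pow_val, Units.val_one] at h4
      have h5 : Fintype.card F = (Fintype.card F - 1) + 1 := by omega
      rw [h5, pow_succ, ← pow_mul, mul_comm G, pow_mul, h4, one_mul]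
    obtain ⟨t, ht⟩ := exists_of_pow_card _ h3
    have ht0 : t ≠ 0 := by
      rintro rfl
      rw [map_zero] at ht
      exact (pow_ne_zero G l.ne_zero) ht.symm
    refine ⟨Units.mk0 t ht0, ?_⟩
    funext i
    apply (algebraMap F (AlgebraicClosure F)).injective
    rw [hl i]
    simp only [hφ, Units.val_mk0, map_mul, map_pow]
    by_cases hxi : x i = 0
    · simp [hxi]
    · rw [ht, ← pow_mul, ← hg i (by simpa [hS] using hxi)]
  · rintro ⟨u, rfl⟩
    obtain ⟨l, hl⟩ := IsAlgClosed.exists_pow_nat_eq (algebraMap F (AlgebraicClosure F) u) hGpos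
    have hl0 : l ≠ 0 := by
      rintro rfl
      rw [zero_pow hGpos.ne'] at hl
      have := (map_eq_zero _).1 hl.symm
      exact u.ne_zero this
    refine ⟨Units.mk0 l hl0, fun i => ?_⟩
    simp only [hφ, Units.val_mk0, map_mul, map_pow]
    by_cases hxi : x i = 0
    · simp [hxi]
    · rw [hg i (by simpa [hS] using hxi), pow_mul, hl]

/-- Embedding of rational nonzero vectors. -/
def emb (F : Type) [Field F] {m : ℕ} (x : Fin (m+1) → F) (hx : x ≠ 0) :
    {v : Fin (m + 1) → AlgebraicClosure F // v ≠ 0} :=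
  ⟨fun i => algebraMap F (AlgebraicClosure F) (x i), by
    intro h
    apply hx
    funext i
    have := congrFun h i
    simpa using this⟩

lemma emb_rat (F : Type) [Field F] [Fintype F] {m : ℕ} (w : Fin (m+1) → ℕ) (x : Fin (m+1) → F) (hx : x ≠ 0) :
    PW.mk F w (emb F x hx) ∈ ratPts F w := by
  refine ⟨emb F x hx, rfl, ?_⟩
  have h : (fun i => (emb F x hx).1 i ^ Fintype.card F) = (emb F x hx).1 := by
    funext i
    simp only [emb, ← map_pow, FiniteField.pow_card]
  refine ⟨by rw [h]; exact (emb F x hx).2, ?_⟩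
  congr 1
  exact Subtype.ext h

lemma rat_emb (F : Type) [Field F] [Fintype F] {m : ℕ} (w : Fin (m+1) → ℕ) (c : PW F w) (hc : c ∈ ratPts F w) :
    ∃ (x : Fin (m+1) → F) (hx : x ≠ 0), PW.mk F w (emb F x hx) = c := by
  obtain ⟨x, hxc, h, hx2⟩ := hc
  rw [← hxc, eq_comm, mk_eq_iff] at hx2
  obtain ⟨l, hl⟩ := hx2
  simp only at hl
  have hq2 : 1 < Fintype.card F := Fintype.one_lt_card
  obtain ⟨μ, hμ⟩ := IsAlgClosed.exists_pow_nat_eq ((l⁻¹ : (AlgebraicClosure F)ˣ) : AlgebraicClosure F)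
    (show 0 < Fintype.card F - 1 by omega)
  have hμ0 : μ ≠ 0 := by
    rintro rfl
    rw [zero_pow (by omega)] at hμ
    exact (l⁻¹).ne_zero hμ.symm
  have hfix : ∀ i, ∃ t : F, algebraMap F (AlgebraicClosure F) t = μ ^ w i * x.1 i := by
    intro i
    apply exists_of_pow_card
    rw [mul_pow, hl i, ← pow_mul, mul_comm (w i), pow_mul, ← mul_assoc, ← mul_pow]
    congr 2
    have h5 : Fintype.card F = (Fintype.card F - 1) + 1 := by omega
    rw [h5, pow_succ, hμ]
    rw [mul_comm, ← mul_assoc]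
    simp
  choose t ht using hfix
  have ht0 : t ≠ 0 := by
    intro h0
    apply x.2
    funext i
    have := ht i
    rw [h0] at this
    simp only [Pi.zero_apply, map_zero] at this ⊢
    exact (mul_eq_zero.1 this.symm).resolve_left (pow_ne_zero _ hμ0)
  refine ⟨t, ht0, ?_⟩
  rw [← hxc, eq_comm, mk_eq_iff]
  exact ⟨Units.mk0 μ hμ0, fun i => ht i⟩

lemma mem_vanish (F : Type) [Field F] [Fintype F] {m : ℕ} (w : Fin (m+1) → ℕ) (d : ℕ)
    (f : MvPolynomial (Fin (m+1)) F) (hf : IsWeightedHomogeneous w f d) (x : Fin (m+1) → F) (hx : x ≠ 0) :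
    PW.mk F w (emb F x hx) ∈ vanishSet F w f ↔ eval x f = 0 := by
  have hev : eval (emb F x hx).1 (MvPolynomial.map (algebraMap F (AlgebraicClosure F)) f) =
      algebraMap F (AlgebraicClosure F) (eval x f) := by
    rw [eval_map]
    exact (eval₂_comp_left (algebraMap F (AlgebraicClosure F)) (RingHom.id F) x f).symm
  have hf' : IsWeightedHomogeneous w (MvPolynomial.map (algebraMap F (AlgebraicClosure F)) f) d := by
    intro a ha
    apply hf
    intro h0
    apply ha
    rw [coeff_map, h0, map_zero]
  constructor
  · intro h
    have := h.2 _ rfl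
    rw [hev] at this
    simpa using this
  · intro h
    refine ⟨emb_rat F w x hx, fun y hy => ?_⟩
    rw [eq_comm, mk_eq_iff] at hy
    obtain ⟨l, hl⟩ := hy
    have : y.1 = fun i => (l : AlgebraicClosure F) ^ w i * (emb F x hx).1 i := funext hl
    rw [this, eval_scale _ w d hf', hev, h]
    simp

theorem count (F : Type) [Field F] [Fintype F] {m : ℕ} (w : Fin (m+1) → ℕ) (hpos : ∀ i, 1 ≤ w i)
    (d : ℕ) (hd : 1 ≤ d) (f : MvPolynomial (Fin (m+1)) F) (hf : IsWeightedHomogeneous w f d) :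
    ZN f = (Fintype.card F - 1) * (vanishSet F w f).ncard + 1 := by
  classical
  have hfin : (ratPts F w).Finite := by
    let φ : {x : Fin (m+1) → F // x ≠ 0} → PW F w := fun x => PW.mk F w (emb F x.1 x.2)
    refine (Set.finite_range φ).subset ?_
    intro c hc
    obtain ⟨x, hx, h⟩ := rat_emb F w c hc
    exact ⟨⟨x, hx⟩, h⟩
  have hV : (vanishSet F w f).Finite := hfin.subset (fun c hc => hc.1)
  set Z := Finset.univ.filter (fun x : Fin (m+1) → F => eval x f = 0) with hZ
  have hZN : ZN f = Z.card := by unfold ZN; congr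
  have h0Z : (0 : Fin (m+1) → F) ∈ Z := by
    simp only [hZ, Finset.mem_filter, Finset.mem_univ, true_and]
    have := eval_scale f w d hf (0:F) 0
    rw [zero_pow (by omega), zero_mul] at this
    rw [← this]
    congr 2
    funext i
    simp
  rw [hZN, ← Finset.card_erase_add_one h0Z, Set.ncard_eq_toFinset_card _ hV]
  congr 1
  have hne : (emb F (1 : Fin (m+1) → F) one_ne_zero).1 ≠ 0 := (emb F (1 : Fin (m+1) → F) one_ne_zero).2
  let ψ : (Fin (m+1) → F) → PW F w := fun x => if hx : x ≠ 0 then PW.mk F w (emb F x hx) else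
    PW.mk F w (emb F 1 one_ne_zero)
  have hψ : ∀ x (hx : x ≠ 0), ψ x = PW.mk F w (emb F x hx) := fun x hx => by simp only [ψ, dif_pos hx]
  rw [Finset.card_eq_sum_card_fiberwise (f := ψ) (t := hV.toFinset)]
  · rw [Finset.sum_congr rfl (g := fun _ => Fintype.card F - 1)]
    · rw [Finset.sum_const, smul_eq_mul, mul_comm]
    · intro c hc
      rw [Set.Finite.mem_toFinset] at hc
      obtain ⟨x, hx, rfl⟩ := rat_emb F w c hc.1
      rw [← card_orbit w hpos x hx]
      congr 1
      ext y
      simp only [Finset.mem_filter, Finset.mem_univ, true_and, Finset.mem_erase]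
      constructor
      · rintro ⟨⟨hy0, hyZ⟩, hy⟩
        rw [hψ y hy0, eq_comm, mk_eq_iff] at hy
        exact hy
      · rintro ⟨l, hl⟩
        have hy0 : y ≠ 0 := by
          rintro rfl
          apply hx
          funext i
          have := hl i
          simp only [Pi.zero_apply, map_zero] at this
          have := (mul_eq_zero.1 this.symm).resolve_left (pow_ne_zero _ l.ne_zero)
          simpa using this
        have he : ψ y = PW.mk F w (emb F x hx) := by
          rw [hψ y hy0, eq_comm, mk_eq_iff]
          exact ⟨l, hl⟩
        refine ⟨⟨hy0, ?_⟩, he⟩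
        rw [hZ, Finset.mem_filter]
        refine ⟨Finset.mem_univ _, ?_⟩
        rw [← mem_vanish F w d f hf y hy0, ← hψ y hy0, he]
        exact hc
  · intro x hx
    rw [Finset.mem_coe, Finset.mem_erase] at hx
    rw [Finset.mem_coe, Set.Finite.mem_toFinset, hψ x hx.1, mem_vanish F w d f hf x hx.1]
    simpa [hZ] using hx.2
lemma pSum_id (q k : ℕ) (hq : 1 ≤ q) : (q - 1) * pSum q k + 1 = q ^ k := by
  unfold pSum
  obtain ⟨r, rfl⟩ : ∃ r, q = r + 1 := ⟨q - 1, by omega⟩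
  induction k with
  | zero => simp
  | succ k ih =>
    rw [Finset.sum_range_succ, mul_add, pow_succ]
    simp only [Nat.add_sub_cancel] at ih ⊢
    nlinarith

/-- The product of the hypersurfaces `x_1 = a x_0^{w_1}`, `a ∈ S`. -/
def gS {F : Type} [Field F] (n w1 : ℕ) (S : Finset F) : MvPolynomial (Fin (n+3)) F :=
  ∏ a ∈ S, (X 1 - C a * X 0 ^ w1)

lemma eval_gS {F : Type} [Field F] (n w1 : ℕ) (S : Finset F) (x : Fin (n+3) → F) :
    eval x (gS n w1 S) = ∏ a ∈ S, (x 1 - a * x 0 ^ w1) := by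
  simp [gS]

lemma gS_ne_zero {F : Type} [Field F] (n w1 : ℕ) (hw1 : 1 ≤ w1) (S : Finset F) :
    gS n w1 S ≠ 0 := by
  intro h
  have h2 := eval_gS n w1 S (fun i => if i = 0 then 0 else 1)
  rw [h] at h2
  have : w1 ≠ 0 := by omega
  simp [this] at h2

lemma gS_homog {F : Type} [Field F] (n w1 : ℕ) (S : Finset F) (w : Fin (n+3) → ℕ)
    (hw0 : w 0 = 1) (hw1 : w 1 = w1) : IsWeightedHomogeneous w (gS n w1 S) (S.card * w1) := by
  have : IsWeightedHomogeneous w (gS n w1 S) (∑ a ∈ S, w1) := by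
    unfold gS
    apply IsWeightedHomogeneous.prod
    intro a _
    have h1 : IsWeightedHomogeneous w (X 1 : MvPolynomial (Fin (n+3)) F) w1 := by
      rw [← hw1]; exact isWeightedHomogeneous_X _ _ _
    have h2 : IsWeightedHomogeneous w (C a * X 0 ^ w1 : MvPolynomial (Fin (n+3)) F) w1 := by
      have := (isWeightedHomogeneous_C w a).mul ((isWeightedHomogeneous_X F w 0).pow w1)
      simpa [hw0] using this
    exact (weightedHomogeneousSubmodule F w w1).sub_mem h1 h2
  simpa using this

lemma ZN_gS {F : Type} [Field F] [Fintype F] (n w1 : ℕ) (hw1p : 1 ≤ w1) (S : Finset F) (hS : S.card ≠ 0)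
    (w : Fin (n+3) → ℕ)
    (hw0 : w 0 = 1) (hw1 : w 1 = w1) :
    Fintype.card F ^ (n+1) * ((Fintype.card F - 1) * S.card + 1) ≤ ZN (gS n w1 S) := by
  classical
  rw [ZN_split (gS n w1 S) w _ hw0 (gS_homog n w1 S w hw0 hw1)]
  have h1 : Fintype.card F ^ (n+1) * S.card ≤ ZN (dehom (gS n w1 S)) := by
    rw [ZN_fiber]
    calc _ = ∑ y : Fin (n+1) → F, S.card := by simp
      _ ≤ _ := by
        apply Finset.sum_le_sum
        intro y _
        apply Finset.card_le_card
        intro t ht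
        rw [Finset.mem_filter, eval_dehom, eval_gS]
        refine ⟨Finset.mem_univ _, Finset.prod_eq_zero ht ?_⟩
        have : (1 : Fin (n+3)) = Fin.succ 0 := rfl
        rw [this]
        simp
  have h2 : Fintype.card F ^ (n+1) ≤ ZN (infpart (gS n w1 S)) := by
    rw [ZN_fiber]
    calc _ = ∑ y : Fin (n+1) → F, 1 := by simp
      _ ≤ _ := by
        apply Finset.sum_le_sum
        intro y _
        rw [Nat.one_le_iff_ne_zero, Finset.card_ne_zero]
        refine ⟨0, ?_⟩
        obtain ⟨a, ha⟩ := Finset.card_ne_zero.1 hS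
        rw [Finset.mem_filter, eval_infpart, eval_gS]
        refine ⟨Finset.mem_univ _, Finset.prod_eq_zero ha ?_⟩
        have : (1 : Fin (n+3)) = Fin.succ 0 := rfl
        have h' : w1 ≠ 0 := by omega
        rw [this]
        simp [h']
  nlinarith [Nat.mul_le_mul_left (Fintype.card F - 1) h1]

lemma lower_small {F : Type} [Field F] [Fintype F] {n : ℕ} (w : Fin (n+3) → ℕ) (w1 e : ℕ)
    (hw0 : w 0 = 1) (hw1 : w 1 = w1) (hw1p : 1 ≤ w1) (he1 : 1 ≤ e) (he : e ≤ Fintype.card F) :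
    ∃ f : MvPolynomial (Fin (n+3)) F, f ≠ 0 ∧ IsWeightedHomogeneous w f (e * w1) ∧
      Fintype.card F ^ (n+1) * ((Fintype.card F - 1) * e + 1) ≤ ZN f := by
  obtain ⟨S, -, hS⟩ := Finset.exists_subset_card_eq (s := (Finset.univ : Finset F)) (n := e) (by simpa using he)
  subst hS
  exact ⟨gS n w1 S, gS_ne_zero n w1 hw1p S, gS_homog n w1 S w hw0 hw1, ZN_gS n w1 hw1p S (by omega) w hw0 hw1⟩

lemma lower_big {F : Type} [Field F] [Fintype F] {n : ℕ} (w : Fin (n+3) → ℕ) (w1 e : ℕ)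
    (hw0 : w 0 = 1) (hw1 : w 1 = w1) (hw1p : 1 ≤ w1) (he : Fintype.card F < e) :
    ∃ f : MvPolynomial (Fin (n+3)) F, f ≠ 0 ∧ IsWeightedHomogeneous w f (e * w1) ∧
      Fintype.card F ^ (n+3) ≤ ZN f := by
  classical
  have hlt : Fintype.card F * w1 < e * w1 := Nat.mul_lt_mul_of_pos_right he hw1p
  refine ⟨X 0 ^ (e * w1 - Fintype.card F * w1) * gS n w1 Finset.univ,
    mul_ne_zero (pow_ne_zero _ (X_ne_zero _)) (gS_ne_zero n w1 hw1p _), ?_, ?_⟩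
  · have := ((isWeightedHomogeneous_X F w 0).pow (e * w1 - Fintype.card F * w1)).mul
      (gS_homog n w1 (Finset.univ : Finset F) w hw0 hw1)
    rw [hw0] at this
    convert this using 1
    simp only [smul_eq_mul, Finset.card_univ]
    omega
  · unfold ZN
    rw [Finset.filter_true_of_mem]
    · simp
    · intro x _
      rw [map_mul, eval_gS]
      by_cases h : x 0 = 0
      · have : e * w1 - Fintype.card F * w1 ≠ 0 := by omega
        simp [h, this]
      · rw [Finset.prod_eq_zero (Finset.mem_univ (x 1 / x 0 ^ w1)), mul_zero]
        field_simp
        simp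
/-- the Aubry–Castryck–Ghorpade–Lachaud–O'Sullivan–Ram conjecture:
the case where `lcm(w_1,…,w_m)` divides `d`. -/
theorem stmt1 (F : Type) [Field F] [Fintype F] (m ℓ : ℕ) (w : Fin (m + 1) → ℕ)
    (hℓ1 : 1 ≤ ℓ) (hℓm : ℓ + 1 ≤ m)
    (hpos : ∀ i, 1 ≤ w i)
    (hw0 : w ⟨0, by omega⟩ = 1)
    (hweq : ∀ i : Fin (m + 1), 1 ≤ (i : ℕ) → (i : ℕ) ≤ ℓ → w i = w ⟨1, by omega⟩)
    (hlt : w ⟨ℓ, by omega⟩ < w ⟨ℓ + 1, by omega⟩)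
    (hmono : ∀ i j : Fin (m + 1), ℓ + 1 ≤ (i : ℕ) → i ≤ j → w i ≤ w j)
    (d : ℕ) (hd : 1 ≤ d)
    (hdvd : (Finset.univ.filter (fun i : Fin (m + 1) => 1 ≤ (i : ℕ))).lcm w ∣ d) :
    eMax F w d =
      min (pSum (Fintype.card F) (m + 1))
        ((d / w ⟨1, by omega⟩) * Fintype.card F ^ (m - 1)
          + pSum (Fintype.card F) (m - 1)) := by
  classical
  obtain ⟨n, rfl⟩ : ∃ n, m = n + 2 := ⟨m - 2, by omega⟩
  set q := Fintype.card F with hq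
  have hq2 : 2 ≤ q := Fintype.one_lt_card
  have hw0' : w 0 = 1 := hw0
  have h1 : (⟨1, by omega⟩ : Fin (n + 2 + 1)) = 1 := rfl
  rw [h1]
  replace hweq : ∀ i : Fin (n + 2 + 1), 1 ≤ (i : ℕ) → (i : ℕ) ≤ ℓ → w i = w 1 := hweq
  have hdv : w 1 ∣ d := (Finset.dvd_lcm (by simp)).trans hdvd
  obtain ⟨e, he⟩ := hdv
  have hde : d = e * w 1 := by rw [he, mul_comm]
  have hw1p := hpos 1
  have hdiv : d / w 1 = e := by rw [hde]; exact Nat.mul_div_cancel _ hw1p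
  have he1 : 1 ≤ e := by
    rcases Nat.eq_zero_or_pos e with h | h
    · rw [h] at hde; omega
    · exact h
  have hle : ∀ i : Fin (n+2), w 1 ≤ w i.succ := by
    intro i
    by_cases hi : (i.succ : ℕ) ≤ ℓ
    · exact (hweq i.succ (by simp) hi).ge
    · have h2 := hweq ⟨ℓ, by omega⟩ hℓ1 le_rfl
      have h3 := hmono ⟨ℓ + 1, by omega⟩ i.succ le_rfl (by
        rw [Fin.le_def]; show ℓ + 1 ≤ (i.succ : ℕ); omega)
      omega
  rw [hdiv]
  have hm1 : n + 2 - 1 = n + 1 := by omega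
  rw [hm1]
  have id1 := pSum_id q (n + 2 + 1) (by omega)
  have id2 := pSum_id q (n + 1) (by omega)
  have idB : q ^ (n+1) * ((q - 1) * e + 1) = (q - 1) * (e * q ^ (n+1) + pSum q (n+1)) + 1 := by
    rw [mul_add (q - 1), add_assoc, id2]; ring
  have hq1 : 0 < q - 1 := by omega
  have hub : ∀ f : MvPolynomial (Fin (n + 2 + 1)) F, f ≠ 0 → IsWeightedHomogeneous w f d →
      (vanishSet F w f).ncard ≤ min (pSum q (n+2+1)) (e * q ^ (n+1) + pSum q (n+1)) := by
    intro f h0 hf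
    have hc := count F w hpos d hd f hf
    have ha := upper w hw0' (w 1) hw1p hle d e hde he1 f hf h0
    have hb := ZN_le_pow f
    rw [← hq] at ha hb hc
    rw [idB, hc] at ha
    rw [← id1, hc] at hb
    exact le_min (Nat.le_of_mul_le_mul_left (by omega) hq1) (Nat.le_of_mul_le_mul_left (by omega) hq1)
  unfold eMax
  apply IsGreatest.csSup_eq
  refine ⟨?_, ?_⟩
  · by_cases heq : e ≤ q
    · obtain ⟨f, h0, hf, hz⟩ := lower_small w (w 1) e hw0' rfl hw1p he1 heq
      rw [← hde] at hf
      refine ⟨f, h0, hf, le_antisymm ?_ (hub f h0 hf)⟩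
      refine (min_le_right _ _).trans ?_
      rw [count F w hpos d hd f hf, ← hq, idB] at hz
      exact Nat.le_of_mul_le_mul_left (by omega) hq1
    · obtain ⟨f, h0, hf, hz⟩ := lower_big (F := F) w (w 1) e hw0' rfl hw1p (by omega)
      rw [← hde] at hf
      refine ⟨f, h0, hf, le_antisymm ?_ (hub f h0 hf)⟩
      refine (min_le_left _ _).trans ?_
      rw [count F w hpos d hd f hf, ← hq, ← id1] at hz
      exact Nat.le_of_mul_le_mul_left (by omega) hq1
  · rintro k ⟨f, h0, hf, rfl⟩
    exact hub f h0 hf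

end
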